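/- Let F be a field of characteristic zero, K = F(t), δ the derivation with δ|_F = 0, δ(t) = t, and P ∈ Mₙ(F) traceless with all eigenvalues rational, say with common fractional part considerations as follows. Suppose the m-th tensor power (Mₙ(K), D_P)^{⊗ m} is split over (K, δ) and m is minimal with this property (the order). Then m divides n. -/

import Mathlib

open Matrix

/-- The `m`-fold Kronecker sum of a square matrix `P ∈ Mₙ(F)`, i.e. the matrix
`∑ i, I ⊗ ⋯ ⊗ P ⊗ ⋯ ⊗ I` (with `P` in the `i`-th slot) acting on the `m`-fold tensor power,
whose index set is `Fin m → Fin n`. -/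
noncomputable def kroneckerSumPow {F : Type*} [Field F] {n : ℕ}
    (P : Matrix (Fin n) (Fin n) F) (m : ℕ) :
    Matrix (Fin m → Fin n) (Fin m → Fin n) F :=
  ∑ i : Fin m, Matrix.of fun v w =>
    P (v i) (w i) * ∏ j ∈ Finset.univ.erase i, (if v j = w j then (1 : F) else 0)

/-- The `m`-th tensor power `(Mₙ(K), D_P)^{⊗ m}` is split over `(K, δ)`: the equation
`δᶜ(Y) = Q_mᵀ Y`, where `Q_m` is the `m`-fold Kronecker sum of `P`, has an invertible
solution over `K = F(t)`. -/
def IsSplitTensorPow {F : Type*} [Field F] {n : ℕ}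
    (δ : RatFunc F → RatFunc F) (P : Matrix (Fin n) (Fin n) F) (m : ℕ) : Prop :=
  ∃ Y : Matrix (Fin m → Fin n) (Fin m → Fin n) (RatFunc F), IsUnit Y.det ∧
    Y.map δ = ((kroneckerSumPow P m).map (algebraMap F (RatFunc F)))ᵀ * Y


section helpers
open Finset
open scoped RatFunc

noncomputable def eulerL {F : Type*} [Field F] (f : LaurentSeries F) : LaurentSeries F :=
  ⟨fun k => (k : F) * f.coeff k, f.isPWO_support.mono (by
    intro k hk hk0
    apply hk
    simp only [hk0, mul_zero])⟩

lemma eulerL_coeff {F : Type*} [Field F] (f : LaurentSeries F) (k : ℤ) :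
    (eulerL f).coeff k = (k : F) * f.coeff k := rfl

lemma eulerL_supp {F : Type*} [Field F] (f : LaurentSeries F) :
    (eulerL f).support ⊆ f.support := by
  intro k hk hk0
  apply hk
  simp only [eulerL_coeff, hk0, mul_zero]

lemma eulerL_add {F : Type*} [Field F] (f g : LaurentSeries F) :
    eulerL (f + g) = eulerL f + eulerL g := by
  ext k
  simp [eulerL_coeff, mul_add]

lemma eulerL_mul {F : Type*} [Field F] (f g : LaurentSeries F) :
    eulerL (f * g) = eulerL f * g + f * eulerL g := by
  ext k
  rw [HahnSeries.coeff_add, eulerL_coeff, HahnSeries.coeff_mul,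
    HahnSeries.coeff_mul_left' f.isPWO_support (eulerL_supp f),
    HahnSeries.coeff_mul_right' g.isPWO_support (eulerL_supp g), Finset.mul_sum,
    ← Finset.sum_add_distrib]
  refine Finset.sum_congr rfl fun ij hij => ?_
  have : ij.1 + ij.2 = k := by simpa using (Finset.mem_antidiagonal.1 hij).2.2
  rw [← this, eulerL_coeff, eulerL_coeff]
  push_cast
  ring

lemma eulerL_single {F : Type*} [Field F] (a : F) (i : ℤ) :
    eulerL (HahnSeries.single i a) = HahnSeries.single i ((i : F) * a) := by
  ext k
  rw [eulerL_coeff]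
  by_cases h : k = i
  · subst h; simp
  · simp [HahnSeries.coeff_single_of_ne h]

lemma algMap_C_laurent {F : Type*} [Field F] (a : F) :
    algebraMap (RatFunc F) (LaurentSeries F) (algebraMap F (RatFunc F) a)
      = HahnSeries.single 0 a := by
  rw [IsScalarTower.algebraMap_apply F (Polynomial F) (RatFunc F),
    ← IsScalarTower.algebraMap_apply (Polynomial F) (RatFunc F) (LaurentSeries F)]
  simp

section
variable {F : Type*} [Field F] (δ : RatFunc F → RatFunc F)

lemma d_euler
    (hadd : ∀ x y : RatFunc F, δ (x + y) = δ x + δ y)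
    (hmul : ∀ x y : RatFunc F, δ (x * y) = δ x * y + x * δ y)
    (hF : ∀ a : F, δ (algebraMap F (RatFunc F) a) = 0)
    (ht : δ RatFunc.X = RatFunc.X) (f : RatFunc F) :
    algebraMap (RatFunc F) (LaurentSeries F) (δ f)
      = eulerL (algebraMap (RatFunc F) (LaurentSeries F) f) := by
  have hC : ∀ a : F, algebraMap (RatFunc F) (LaurentSeries F) (algebraMap F (RatFunc F) a)
      = HahnSeries.single 0 a := by
    exact algMap_C_laurent
  have hX : algebraMap (RatFunc F) (LaurentSeries F) RatFunc.X = HahnSeries.single 1 1 :=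
    RatFunc.coe_X
  have hpoly : ∀ p : Polynomial F, algebraMap (RatFunc F) (LaurentSeries F)
      (δ (algebraMap (Polynomial F) (RatFunc F) p))
      = eulerL (algebraMap (RatFunc F) (LaurentSeries F)
        (algebraMap (Polynomial F) (RatFunc F) p)) := by
    intro p
    induction p using Polynomial.induction_on with
    | C a =>
      have : algebraMap (Polynomial F) (RatFunc F) (Polynomial.C a)
        = algebraMap F (RatFunc F) a := by simp
      rw [this, hF, hC, eulerL_single]; simp
    | add p q hp hq => simp only [map_add, hadd, eulerL_add, hp, hq]
    | monomial n a h =>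
      rw [pow_succ, ← mul_assoc]
      generalize Polynomial.C a * Polynomial.X ^ n = r at h ⊢
      rw [map_mul (algebraMap (Polynomial F) (RatFunc F)), hmul, RatFunc.algebraMap_X, ht]
      rw [map_add, map_mul, map_mul, eulerL_mul, h, hX, eulerL_single]
      simp
  induction f using RatFunc.induction_on with
  | f p q hq =>
    have hq' : algebraMap (Polynomial F) (RatFunc F) q ≠ 0 :=
      RatFunc.algebraMap_ne_zero hq
    set Q := algebraMap (Polynomial F) (RatFunc F) q
    set Pp := algebraMap (Polynomial F) (RatFunc F) p
    have h1 := hpoly p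
    have h2 := hpoly q
    have h3 : Pp = (Pp / Q) * Q := by field_simp
    change algebraMap _ _ (δ Pp) = eulerL (algebraMap _ _ Pp) at h1
    change algebraMap _ _ (δ Q) = eulerL (algebraMap _ _ Q) at h2
    rw [h3, hmul, map_mul, eulerL_mul, map_add, map_mul, map_mul, h2] at h1
    have hq2 : algebraMap (RatFunc F) (LaurentSeries F) Q ≠ 0 := by simpa using hq'
    exact mul_right_cancel₀ hq2 (add_right_cancel h1)

/-- A fundamental matrix forces the integer-eigenvalue eigenvectors to span. -/
lemma span_of_split {ι : Type*} [Fintype ι] [DecidableEq ι]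
    (hadd : ∀ x y : RatFunc F, δ (x + y) = δ x + δ y)
    (hmul : ∀ x y : RatFunc F, δ (x * y) = δ x * y + x * δ y)
    (hF : ∀ a : F, δ (algebraMap F (RatFunc F) a) = 0)
    (ht : δ RatFunc.X = RatFunc.X) (M : Matrix ι ι F) (Y : Matrix ι ι (RatFunc F))
    (hY : IsUnit Y.det) (h : Y.map δ = M.map (algebraMap F (RatFunc F)) * Y) :
    Submodule.span F {v : ι → F | ∃ k : ℤ, M *ᵥ v = (k : F) • v} = ⊤ := by
  by_contra hne
  obtain ⟨f, hf0, hf⟩ := Submodule.exists_le_ker_of_lt_top _ (lt_top_iff_ne_top.2 hne)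
  let L := algebraMap (RatFunc F) (LaurentSeries F)
  have hcoef : ∀ (j : ι) (k : ℤ), M *ᵥ (fun i => (L (Y i j)).coeff k)
      = (k : F) • (fun i => (L (Y i j)).coeff k) := by
    intro j k
    ext i
    have h1 := congrFun (congrFun h i) j
    rw [Matrix.map_apply, Matrix.mul_apply] at h1
    have h2 := congrArg (fun z => (L z).coeff k) h1
    simp only [L] at h2
    rw [d_euler δ hadd hmul hF ht, eulerL_coeff, map_sum, HahnSeries.coeff_sum] at h2
    rw [Pi.smul_apply, smul_eq_mul, h2, Matrix.mulVec, dotProduct]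
    refine Finset.sum_congr rfl fun b _ => ?_
    rw [map_mul, Matrix.map_apply, algMap_C_laurent]
    exact (HahnSeries.coeff_single_zero_mul).symm
  let c : ι → F := fun i => f (Pi.single i 1)
  have hfc : ∀ v : ι → F, f v = ∑ i, c i * v i := by
    intro v
    conv_lhs => rw [pi_eq_sum_univ' v]
    rw [map_sum]
    refine Finset.sum_congr rfl fun i _ => ?_
    rw [map_smul, smul_eq_mul, mul_comm]
  have hzero : (fun i => algebraMap F (RatFunc F) (c i)) ᵥ* Y = 0 := by
    ext1 j
    apply (algebraMap (RatFunc F) (LaurentSeries F)).injective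
    ext k
    have h1 : f (fun i => (L (Y i j)).coeff k) = 0 :=
      hf (Submodule.subset_span ⟨k, hcoef j k⟩)
    rw [hfc] at h1
    rw [Pi.zero_apply, map_zero, HahnSeries.coeff_zero, ← h1, Matrix.vecMul, dotProduct, map_sum,
      HahnSeries.coeff_sum]
    refine Finset.sum_congr rfl fun b _ => ?_
    rw [map_mul, algMap_C_laurent]
    exact (HahnSeries.coeff_single_zero_mul)
  have hc0 : (fun i => algebraMap F (RatFunc F) (c i)) = 0 := by
    by_contra hne0
    exact hY.ne_zero (Matrix.exists_vecMul_eq_zero_iff.1 ⟨_, hne0, hzero⟩)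
  apply hf0
  ext1 i
  have := congrFun hc0 i
  ext
  simpa [c] using this

lemma d_zpow
    (hmul : ∀ x y : RatFunc F, δ (x * y) = δ x * y + x * δ y)
    (hF : ∀ a : F, δ (algebraMap F (RatFunc F) a) = 0)
    (ht : δ RatFunc.X = RatFunc.X) (k : ℤ) :
    δ (RatFunc.X ^ k) = (k : RatFunc F) * RatFunc.X ^ k := by
  have hX : (RatFunc.X : RatFunc F) ≠ 0 := RatFunc.X_ne_zero
  have h1 : δ 1 = 0 := by simpa using hF 1
  have key : ∀ j : ℤ, δ (RatFunc.X ^ (j+1)) = (δ (RatFunc.X ^ j) + RatFunc.X ^ j) * RatFunc.X := by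
    intro j
    rw [zpow_add_one₀ hX, hmul, ht]; ring
  induction k using Int.induction_on with
  | zero => simpa using h1
  | succ i ih => rw [key, ih, zpow_add_one₀ hX]; push_cast; ring
  | pred i ih =>
    have h2 := key (-(i:ℤ) - 1)
    rw [sub_add_cancel, ih] at h2
    apply mul_right_cancel₀ hX
    have h3 : (RatFunc.X : RatFunc F) ^ (-(i:ℤ)) = RatFunc.X ^ (-(i:ℤ) - 1) * RatFunc.X := by
      rw [← zpow_add_one₀ hX, sub_add_cancel]
    rw [h3] at h2
    push_cast at h2 ⊢
    linear_combination -h2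

lemma d_prod {α : Type*} [DecidableEq α]
    (hmul : ∀ x y : RatFunc F, δ (x * y) = δ x * y + x * δ y)
    (hF : ∀ a : F, δ (algebraMap F (RatFunc F) a) = 0)
    (s : Finset α) (f : α → RatFunc F) :
    δ (∏ j ∈ s, f j) = ∑ i ∈ s, δ (f i) * ∏ j ∈ s.erase i, f j := by
  have h1 : δ 1 = 0 := by simpa using hF 1
  induction s using Finset.induction_on with
  | empty => simpa using h1
  | insert a s ha ih =>
    rw [Finset.prod_insert ha, hmul, ih, Finset.sum_insert ha, Finset.erase_insert ha,
      Finset.mul_sum]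
    congr 1
    refine Finset.sum_congr rfl fun i hi => ?_
    have hia : a ≠ i := fun h => ha (h ▸ hi)
    rw [Finset.erase_insert_of_ne hia, Finset.prod_insert (by simp [ha])]
    ring

end

section kron
variable {F : Type*} [Field F] {n : ℕ}

lemma kron_apply (P : Matrix (Fin n) (Fin n) F) (m : ℕ) (h : Fin m → Fin n → F)
    (v : Fin m → Fin n) :
    ∑ w, kroneckerSumPow P m v w * ∏ j, h j (w j)
      = ∑ i, (∑ b, P (v i) b * h i b) * ∏ j ∈ Finset.univ.erase i, h j (v j) := by
  simp only [kroneckerSumPow, Matrix.sum_apply, Matrix.of_apply, Finset.sum_mul]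
  rw [Finset.sum_comm]
  refine Finset.sum_congr rfl fun i _ => ?_
  rw [← Finset.sum_mul]
  let g : Fin m → Fin n → F := fun j b =>
    (if j = i then P (v i) b else if v j = b then 1 else 0) * h j b
  have h1 : ∀ w : Fin m → Fin n, P (v i) (w i) * (∏ j ∈ Finset.univ.erase i,
      (if v j = w j then (1 : F) else 0)) * ∏ j, h j (w j) = ∏ j, g j (w j) := by
    intro w
    simp only [g, Finset.prod_mul_distrib]
    congr 1
    rw [← Finset.mul_prod_erase Finset.univ _ (Finset.mem_univ i), if_pos rfl]
    congr 1
    refine Finset.prod_congr rfl fun j hj => ?_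
    rw [if_neg (Finset.ne_of_mem_erase hj)]
  simp only [h1]
  have h2 := Finset.prod_univ_sum (fun _ : Fin m => (Finset.univ : Finset (Fin n))) g
  rw [Fintype.piFinset_univ] at h2
  rw [← h2, ← Finset.mul_prod_erase Finset.univ _ (Finset.mem_univ i)]
  congr 1
  · simp [g]
  · refine Finset.prod_congr rfl fun j hj => ?_
    simp [g, Finset.ne_of_mem_erase hj]

lemma kron_transpose (P : Matrix (Fin n) (Fin n) F) (m : ℕ) :
    (kroneckerSumPow P m)ᵀ = kroneckerSumPow Pᵀ m := by
  ext v w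
  simp only [kroneckerSumPow, Matrix.sum_apply, Matrix.of_apply, Matrix.transpose_apply]
  simp only [eq_comm]

lemma kron_map {K : Type*} [Field K] (f : F →+* K) (P : Matrix (Fin n) (Fin n) F) (m : ℕ) :
    (kroneckerSumPow P m).map f = kroneckerSumPow (P.map f) m := by
  ext v w
  simp only [kroneckerSumPow, Matrix.sum_apply, Matrix.of_apply, Matrix.map_apply, map_sum,
    map_mul, map_prod]
  simp only [apply_ite f, map_one, map_zero]

end kron

section main
variable {F : Type*} [Field F] {n : ℕ}

lemma diag_of_span (M : Matrix (Fin n) (Fin n) F)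
    (hS : Submodule.span F {v : Fin n → F | ∃ k : ℤ, M *ᵥ v = (k : F) • v} = ⊤) :
    ∃ (T T' : Matrix (Fin n) (Fin n) F) (a : Fin n → ℤ), T * T' = 1 ∧
      M * T = T * Matrix.diagonal (fun i => (a i : F)) := by
  let b := Module.Basis.ofSpan hS.ge
  have hb : ∀ i, ∃ k : ℤ, M *ᵥ (b i) = (k : F) • b i := fun i =>
    Module.Basis.ofSpan_subset hS.ge ⟨i, rfl⟩
  let e := b.indexEquiv (Pi.basisFun F (Fin n))
  let b' := b.reindex e
  have hb' : ∀ i, ∃ k : ℤ, M *ᵥ (b' i) = (k : F) • b' i := by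
    intro i
    simpa [b'] using hb (e.symm i)
  choose a ha using hb'
  refine ⟨(Pi.basisFun F (Fin n)).toMatrix b', b'.toMatrix (Pi.basisFun F (Fin n)), a,
    Module.Basis.toMatrix_mul_toMatrix_flip _ _, ?_⟩
  ext i j
  rw [Matrix.mul_diagonal]
  have := congrFun (ha j) i
  simp only [Matrix.mulVec, dotProduct, Pi.smul_apply, smul_eq_mul] at this
  simp only [Matrix.mul_apply, Module.Basis.toMatrix_apply, Pi.basisFun_repr]
  rw [this, mul_comm]

lemma kron_eigen (P : Matrix (Fin n) (Fin n) F) (m : ℕ) (u : Fin n → F) (l : F)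
    (hu : P *ᵥ u = l • u) :
    kroneckerSumPow P m *ᵥ (fun w => ∏ j, u (w j)) = ((m : F) * l) • (fun w => ∏ j, u (w j)) := by
  ext v
  rw [Matrix.mulVec, dotProduct, kron_apply P m (fun _ => u) v]
  have h : ∀ i, ∑ b, P i b * u b = l * u i := fun i => by
    simpa [Matrix.mulVec, dotProduct] using congrFun hu i
  simp only [h, mul_assoc, Finset.mul_prod_erase Finset.univ (fun j => u (v j)) (Finset.mem_univ _)]
  simp [mul_assoc]

/-- `v ↦ v ⊗ u ⊗ ⋯ ⊗ u`, with the free slot at `i0`. -/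
def insMat {m : ℕ} (i0 : Fin m) (u : Fin n → F) : Matrix (Fin m → Fin n) (Fin n) F :=
  fun w a => ∏ j, (if j = i0 then (if w j = a then 1 else 0) else u (w j))

lemma insMat_eq {m : ℕ} (i0 : Fin m) (u : Fin n → F) (w : Fin m → Fin n) (a : Fin n) :
    insMat i0 u w a = (if w i0 = a then 1 else 0) * ∏ j ∈ Finset.univ.erase i0, u (w j) := by
  rw [insMat, ← Finset.mul_prod_erase Finset.univ _ (Finset.mem_univ i0), if_pos rfl]
  congr 1
  refine Finset.prod_congr rfl fun j hj => ?_
  rw [if_neg (Finset.ne_of_mem_erase hj)]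

lemma kron_ins (P : Matrix (Fin n) (Fin n) F) (m : ℕ) (i0 : Fin m) (u : Fin n → F) (l : F)
    (hu : P *ᵥ u = l • u) :
    kroneckerSumPow P m * insMat i0 u
      = insMat i0 u * P + (((m : F) - 1) * l) • insMat i0 u := by
  have h : ∀ i, ∑ b, P i b * u b = l * u i := fun i => by
    simpa [Matrix.mulVec, dotProduct] using congrFun hu i
  ext v a
  rw [Matrix.mul_apply]
  have h1 := kron_apply P m (fun j b => if j = i0 then (if b = a then 1 else 0) else u b) v
  rw [← Finset.add_sum_erase Finset.univ _ (Finset.mem_univ i0)] at h1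
  refine h1.trans ?_
  rw [Matrix.add_apply, Matrix.mul_apply, Matrix.smul_apply]
  congr 1
  · simp only [insMat_eq]
    simp only [if_true, mul_ite, mul_one, mul_zero, ite_mul, one_mul, zero_mul,
      Finset.sum_ite_eq, Finset.sum_ite_eq', Finset.mem_univ]
    rw [mul_comm]
    congr 1
    refine Finset.prod_congr rfl fun j hj => ?_
    rw [if_neg (Finset.ne_of_mem_erase hj)]
  · have h2 : ∀ i ∈ Finset.univ.erase i0,
        (∑ b, P (v i) b * (if i = i0 then (if b = a then 1 else 0) else u b)) *
          ∏ j ∈ Finset.univ.erase i, (if j = i0 then (if v j = a then 1 else 0) else u (v j))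
        = l * insMat i0 u v a := by
      intro i hi
      simp only [if_neg (Finset.ne_of_mem_erase hi)]
      rw [h, insMat, ← Finset.mul_prod_erase Finset.univ _ (Finset.mem_univ i),
        if_neg (Finset.ne_of_mem_erase hi), mul_assoc]
    rw [Finset.sum_congr rfl h2, Finset.sum_const, Finset.card_erase_of_mem (Finset.mem_univ _),
      Finset.card_univ, Fintype.card_fin, nsmul_eq_mul, Nat.cast_sub (by have := i0.pos; omega)]
    simp [mul_assoc]

lemma insMat_surj {m : ℕ} (i0 : Fin m) (u : Fin n → F) (hu : u ≠ 0) :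
    ∃ C : Matrix (Fin m → Fin n) (Fin n) F, (insMat i0 u)ᵀ * C = 1 := by
  obtain ⟨b0, hb0⟩ := Function.ne_iff.1 hu
  rw [Pi.zero_apply] at hb0
  let c : F := ∏ _j ∈ Finset.univ.erase i0, u b0
  have hc : c ≠ 0 := Finset.prod_ne_zero_iff.2 fun _ _ => hb0
  refine ⟨Matrix.of fun w a => if w = (fun j => if j = i0 then a else b0) then c⁻¹ else 0, ?_⟩
  ext a' a
  rw [Matrix.mul_apply]
  simp only [Matrix.transpose_apply, Matrix.of_apply, mul_ite, mul_zero, Finset.sum_ite_eq', Finset.mem_univ,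
    if_true, insMat_eq, Matrix.one_apply]
  have : ∏ j ∈ Finset.univ.erase i0, u (if j = i0 then a else b0) = c :=
    Finset.prod_congr rfl fun j hj => by rw [if_neg (Finset.ne_of_mem_erase hj)]
  rw [this, mul_assoc, mul_inv_cancel₀ hc, mul_one]
  simp only [eq_comm]

/-- Consequences of splitness for `P`. -/
lemma struct_of_span (P : Matrix (Fin n) (Fin n) F) (m : ℕ) (hm : 0 < m) (u : Fin n → F) (l : F)
    (hu0 : u ≠ 0) (hu : P *ᵥ u = l • u)
    (hS : Submodule.span F {y : (Fin m → Fin n) → F |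
      ∃ k : ℤ, (kroneckerSumPow P m)ᵀ *ᵥ y = (k : F) • y} = ⊤) :
    (∃ z : ℤ, (m : F) * l = z) ∧
    Submodule.span F {v : Fin n → F | ∃ k : ℤ, (Pᵀ - l • 1) *ᵥ v = (k : F) • v} = ⊤ := by
  have hz : ∃ z : ℤ, (m : F) * l = z := by
    by_contra hno
    obtain ⟨b0, hb0⟩ := Function.ne_iff.1 hu0
    rw [Pi.zero_apply] at hb0
    let c : (Fin m → Fin n) → F := fun w => ∏ j, u (w j)
    have hle : Submodule.span F {y : (Fin m → Fin n) → F |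
      ∃ k : ℤ, (kroneckerSumPow P m)ᵀ *ᵥ y = (k : F) • y} ≤
        LinearMap.ker (dotProductBilin F F c) := by
      rw [Submodule.span_le]
      rintro y ⟨k, hk⟩
      have h1 := congrArg (fun z => c ⬝ᵥ z) hk
      rw [Matrix.dotProduct_mulVec, Matrix.vecMul_transpose, kron_eigen P m u l hu,
        smul_dotProduct, dotProduct_smul, smul_eq_mul, smul_eq_mul] at h1
      by_contra h2
      have h2' : c ⬝ᵥ y ≠ 0 := h2
      exact hno ⟨k, mul_right_cancel₀ h2' h1⟩
    rw [hS] at hle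
    have h3 : c ⬝ᵥ (Pi.single (fun _ => b0) 1) = 0 := hle (Submodule.mem_top)
    rw [dotProduct_single, mul_one] at h3
    exact (Finset.prod_ne_zero_iff.2 fun _ _ => hb0) h3
  refine ⟨hz, ?_⟩
  obtain ⟨z, hz⟩ := hz
  let i0 : Fin m := ⟨0, hm⟩
  obtain ⟨C, hC⟩ := insMat_surj i0 u hu0
  have hk := congrArg Matrix.transpose (kron_ins P m i0 u l hu)
  rw [Matrix.transpose_mul, Matrix.transpose_add, Matrix.transpose_mul,
    Matrix.transpose_smul] at hk
  have hsurj : Submodule.map (Matrix.mulVecLin (insMat i0 u)ᵀ) ⊤ = ⊤ := by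
    rw [Submodule.map_top, LinearMap.range_eq_top]
    intro v
    exact ⟨C *ᵥ v, by rw [Matrix.mulVecLin_apply, Matrix.mulVec_mulVec, hC, Matrix.one_mulVec]⟩
  rw [← hS, Submodule.map_span] at hsurj
  rw [eq_top_iff, ← hsurj]
  apply Submodule.span_mono
  rintro _ ⟨y, ⟨k, hy⟩, rfl⟩
  refine ⟨k - z, ?_⟩
  have h1 := congrArg (fun A => A *ᵥ y) hk
  simp only [Matrix.add_mulVec, Matrix.smul_mulVec, ← Matrix.mulVec_mulVec, hy,
    Matrix.mulVec_smul] at h1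
  rw [Matrix.mulVecLin_apply, Matrix.sub_mulVec, Matrix.smul_mulVec, Matrix.one_mulVec]
  generalize (insMat i0 u)ᵀ *ᵥ y = x at h1 ⊢
  push_cast
  rw [← hz, sub_smul, h1]
  module

lemma split_of_diag [CharZero F] (δ : RatFunc F → RatFunc F)
    (hmul : ∀ x y : RatFunc F, δ (x * y) = δ x * y + x * δ y)
    (hF : ∀ a : F, δ (algebraMap F (RatFunc F) a) = 0)
    (ht : δ RatFunc.X = RatFunc.X)
    (P T T' : Matrix (Fin n) (Fin n) F) (l : F) (a : Fin n → ℤ) (hT : T * T' = 1)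
    (hPT : (Pᵀ - l • 1) * T = T * Matrix.diagonal (fun i => (a i : F)))
    (k : ℕ) (z : ℤ) (hz : (k : F) * l = z) : IsSplitTensorPow δ P k := by
  have hX : (RatFunc.X : RatFunc F) ≠ 0 := RatFunc.X_ne_zero
  let f := algebraMap F (RatFunc F)
  let Y1 : Matrix (Fin n) (Fin n) (RatFunc F) := fun i j => f (T i j) * RatFunc.X ^ (a j)
  let Y2 : Matrix (Fin n) (Fin n) (RatFunc F) := fun i j => RatFunc.X ^ (-a i) * f (T' i j)
  have hY12 : ∀ i j, ∑ c, Y1 i c * Y2 c j = if i = j then 1 else 0 := by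
    intro i j
    have h1 := congrArg f (congrFun (congrFun hT i) j)
    rw [Matrix.mul_apply, map_sum, Matrix.one_apply, apply_ite f, map_one, map_zero] at h1
    rw [← h1]
    refine Finset.sum_congr rfl fun c _ => ?_
    simp only [Y1, Y2, _root_.zpow_neg, map_mul]
    have := zpow_ne_zero (a c) hX
    field_simp
  have hdY1 : ∀ i j, ∑ c, (Pᵀ.map f) i c * Y1 c j = δ (Y1 i j) + f l * Y1 i j := by
    intro i j
    have h1 := congrArg f (congrFun (congrFun hPT i) j)
    rw [Matrix.mul_diagonal, Matrix.sub_mul, Matrix.smul_mul, Matrix.one_mul, Matrix.sub_apply,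
      Matrix.smul_apply, Matrix.mul_apply, map_sub, map_sum, smul_eq_mul, map_mul, map_mul,
      map_intCast] at h1
    simp only [Y1, hmul, hF, f, d_zpow δ hmul hF ht]
    simp only [f] at h1
    simp only [← mul_assoc, ← Finset.sum_mul, Matrix.map_apply]
    simp only [map_mul] at h1
    linear_combination (RatFunc.X ^ (a j)) * h1
  let Y : Matrix (Fin k → Fin n) (Fin k → Fin n) (RatFunc F) :=
    fun v w => RatFunc.X ^ z * ∏ j, Y1 (v j) (w j)
  let Yi : Matrix (Fin k → Fin n) (Fin k → Fin n) (RatFunc F) :=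
    fun v w => RatFunc.X ^ (-z) * ∏ j, Y2 (v j) (w j)
  refine ⟨Y, ?_, ?_⟩
  · rw [← Matrix.isUnit_iff_isUnit_det]
    apply IsUnit.of_mul_eq_one Yi
    ext v w
    rw [Matrix.mul_apply]
    have h1 : ∀ x, Y v x * Yi x w = ∏ j, (Y1 (v j) (x j) * Y2 (x j) (w j)) := by
      intro x
      simp only [Y, Yi, Finset.prod_mul_distrib, _root_.zpow_neg]
      have := zpow_ne_zero z hX
      field_simp
    simp only [h1]
    have h2 := Finset.prod_univ_sum (fun _ : Fin k => (Finset.univ : Finset (Fin n)))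
      (fun j c => Y1 (v j) c * Y2 c (w j))
    rw [Fintype.piFinset_univ] at h2
    rw [← h2]
    simp only [hY12, Matrix.one_apply]
    by_cases hvw : v = w
    · simp [hvw]
    · rw [if_neg hvw]
      obtain ⟨j, hj⟩ := Function.ne_iff.1 hvw
      exact Finset.prod_eq_zero (Finset.mem_univ j) (if_neg hj)
  · rw [kron_map, kron_transpose]
    ext v w
    rw [Matrix.map_apply, Matrix.mul_apply]
    have h1 := kron_apply (Pᵀ.map f) k (fun j b => Y1 b (w j)) v
    simp only [hdY1] at h1
    have h2 : ∑ x, kroneckerSumPow (Pᵀ.map f) k v x * Y x w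
        = RatFunc.X ^ z * ∑ x, kroneckerSumPow (Pᵀ.map f) k v x * ∏ j, Y1 (x j) (w j) := by
      rw [Finset.mul_sum]
      refine Finset.sum_congr rfl fun x _ => ?_
      simp only [Y]; ring
    refine Eq.trans ?_ h2.symm
    rw [h1]
    simp only [Y]
    rw [hmul, d_zpow δ hmul hF ht, d_prod δ hmul hF]
    simp only [add_mul, Finset.sum_add_distrib, mul_assoc,
      Finset.mul_prod_erase Finset.univ (fun j => Y1 (v j) (w j)) (Finset.mem_univ _)]
    have hz' := congrArg f hz
    rw [map_mul, map_natCast, map_intCast] at hz'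
    rw [Finset.sum_const, Finset.card_univ, Fintype.card_fin, nsmul_eq_mul, ← hz']
    ring

end main
end helpers

/-- Let `K = F(t)` with `δ|_F = 0`, `δ(t) = t`, and `P ∈ Mₙ(F)` traceless with
all eigenvalues rational. If `m` is the order of `(Mₙ(K), D_P)`, i.e. the least positive integer
such that `(Mₙ(K), D_P)^{⊗ m}` is split over `(K, δ)`, then `m` divides `n`. -/
theorem stmt19 {F : Type*} [Field F] [CharZero F] {n : ℕ}
    (δ : RatFunc F → RatFunc F)
    (hadd : ∀ x y : RatFunc F, δ (x + y) = δ x + δ y)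
    (hmul : ∀ x y : RatFunc F, δ (x * y) = δ x * y + x * δ y)
    (hF : ∀ a : F, δ (algebraMap F (RatFunc F) a) = 0)
    (ht : δ RatFunc.X = RatFunc.X)
    (P : Matrix (Fin n) (Fin n) F) (htr : P.trace = 0)
    (heig : ∀ μ ∈ spectrum (AlgebraicClosure F) (P.map (algebraMap F (AlgebraicClosure F))),
      ∃ q : ℚ, μ = (q : AlgebraicClosure F))
    (m : ℕ) (hm : 0 < m)
    (hsplit : IsSplitTensorPow δ P m)
    (hmin : ∀ k : ℕ, 0 < k → IsSplitTensorPow δ P k → m ≤ k) :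
    m ∣ n := by
  rcases Nat.eq_zero_or_pos n with hn | hn
  · rw [hn]; exact dvd_zero m
  have : Nonempty (Fin n) := ⟨⟨0, hn⟩⟩
  -- an eigenvector over `F`
  obtain ⟨l, u, hu0, hu⟩ : ∃ (l : F) (u : Fin n → F), u ≠ 0 ∧ P *ᵥ u = l • u := by
    obtain ⟨μ, hμ⟩ := spectrum.nonempty_of_isAlgClosed_of_finiteDimensional (AlgebraicClosure F)
      (P.map (algebraMap F (AlgebraicClosure F)))
    obtain ⟨q, rfl⟩ := heig μ hμ
    rw [spectrum.mem_iff, Matrix.isUnit_iff_isUnit_det, isUnit_iff_ne_zero, not_not] at hμ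
    have h1 : (algebraMap (AlgebraicClosure F) (Matrix (Fin n) (Fin n) (AlgebraicClosure F))
        (q : AlgebraicClosure F) - P.map (algebraMap F (AlgebraicClosure F)))
        = (algebraMap F (AlgebraicClosure F)).mapMatrix ((q : F) • 1 - P) := by
      ext i j
      simp [Matrix.algebraMap_matrix_apply, Matrix.one_apply, apply_ite]
    rw [h1, ← RingHom.map_det, map_eq_zero] at hμ
    obtain ⟨u, hu0, hu⟩ := Matrix.exists_mulVec_eq_zero_iff.2 hμ
    refine ⟨q, u, hu0, ?_⟩
    rw [Matrix.sub_mulVec, Matrix.smul_mulVec, Matrix.one_mulVec, sub_eq_zero] at hu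
    exact hu.symm
  obtain ⟨Y, hYdet, hY⟩ := hsplit
  have hspan := span_of_split δ hadd hmul hF ht (kroneckerSumPow P m)ᵀ Y hYdet
    (by rw [hY, Matrix.transpose_map])
  obtain ⟨⟨z, hz⟩, hS⟩ := struct_of_span P m hm u l hu0 hu hspan
  obtain ⟨T, T', a, hT, hPT⟩ := diag_of_span _ hS
  -- the trace
  have hnl : (n : F) * l = ((-∑ i, a i : ℤ) : F) := by
    have h1 : Pᵀ - l • 1 = T * Matrix.diagonal (fun i => (a i : F)) * T' := by
      rw [← hPT, Matrix.mul_assoc, hT, Matrix.mul_one]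
    have h2 := congrArg Matrix.trace h1
    rw [Matrix.trace_mul_comm, ← Matrix.mul_assoc, mul_eq_one_comm.1 hT, Matrix.one_mul,
      Matrix.trace_diagonal, Matrix.trace_sub, Matrix.trace_transpose, htr, Matrix.trace_smul,
      Matrix.trace_one, Fintype.card_fin, smul_eq_mul] at h2
    push_cast
    rw [← h2]
    ring
  have hg : ((Nat.gcd m n : ℕ) : F) * l
      = ((z * Nat.gcdA m n + (-∑ i, a i) * Nat.gcdB m n : ℤ) : F) := by
    have h1 := congrArg (fun x : ℤ => (x : F)) (Nat.gcd_eq_gcd_ab m n)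
    simp only [Int.cast_add, Int.cast_mul, Int.cast_natCast] at h1
    rw [h1, Int.cast_add, Int.cast_mul, Int.cast_mul, ← hz, ← hnl]
    ring
  have hle := hmin _ (Nat.gcd_pos_of_pos_left n hm)
    (split_of_diag δ hmul hF ht P T T' l a hT hPT _ _ hg)
  have : Nat.gcd m n = m := le_antisymm (Nat.gcd_le_left n hm) hle
  exact Nat.gcd_eq_left_iff_dvd.1 this
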